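/- Marstrand projection theorem (Euclidean case): if K ⊆ ℝ² is a Borel set with Hausdorff dimension greater than 1, then for Lebesgue-almost every θ ∈ ℝ, the orthogonal projection π_θ(K) onto the line through the origin in direction (cos θ, sin θ) has positive one-dimensional Lebesgue measure. -/

import Mathlib

open MeasureTheory

namespace Marstrand

open scoped ENNReal NNReal

abbrev E2 := EuclideanSpace ℝ (Fin 2)

/-- index of the dyadic square of level `n` containing `x` -/
noncomputable def idx (n : ℕ) (x : E2) : ℤ × ℤ := (⌊2 ^ n * x 0⌋, ⌊2 ^ n * x 1⌋)

/-- dyadic square -/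
def cube (n : ℕ) (p : ℤ × ℤ) : Set E2 := {x | idx n x = p}

def par (p : ℤ × ℤ) : ℤ × ℤ := (p.1 / 2, p.2 / 2)

def ch (p : ℤ × ℤ) : Finset (ℤ × ℤ) :=
  ({2 * p.1, 2 * p.1 + 1} : Finset ℤ) ×ˢ ({2 * p.2, 2 * p.2 + 1} : Finset ℤ)

lemma mem_ch {p q : ℤ × ℤ} : q ∈ ch p ↔ par q = p := by
  obtain ⟨a, b⟩ := p
  obtain ⟨c, d⟩ := q
  simp only [ch, par, Finset.mem_product, Finset.mem_insert, Finset.mem_singleton, Prod.mk.injEq]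
  omega

lemma mem_cube {n : ℕ} {p : ℤ × ℤ} {x : E2} : x ∈ cube n p ↔ idx n x = p := Iff.rfl

lemma par_idx (n : ℕ) (x : E2) : par (idx (n + 1) x) = idx n x := by
  have h : ∀ t : ℝ, ⌊(2:ℝ) ^ (n + 1) * t⌋ / 2 = ⌊(2:ℝ) ^ n * t⌋ := by
    intro t
    have := Int.floor_div_natCast ((2:ℝ) ^ (n + 1) * t) 2
    push_cast at this
    rw [← this]
    congr 1
    rw [pow_succ]; ring
  simp only [par, idx, h]

lemma idx_mono {m n : ℕ} (h : m ≤ n) {x y : E2} (hxy : idx n x = idx n y) :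
    idx m x = idx m y := by
  induction n, h using Nat.le_induction with
  | base => exact hxy
  | succ k hk ih =>
    apply ih
    rw [← par_idx k x, ← par_idx k y, hxy]

lemma measurable_idx (n : ℕ) : Measurable (idx n) := by
  unfold idx
  fun_prop

lemma measurableSet_cube (n : ℕ) (p : ℤ × ℤ) : MeasurableSet (cube n p) :=
  measurable_idx n (MeasurableSet.singleton p)

lemma dist_le_of_coord {x y : E2} {r : ℝ} (h0 : |x 0 - y 0| ≤ r) (h1 : |x 1 - y 1| ≤ r) :
    dist x y ≤ 2 * r := by
  have hr : 0 ≤ r := (abs_nonneg _).trans h0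
  rw [EuclideanSpace.dist_eq]
  apply Real.sqrt_le_iff.mpr
  refine ⟨by linarith, ?_⟩
  simp only [Fin.sum_univ_two, Real.dist_eq]
  have a0 := mul_self_le_mul_self (abs_nonneg _) h0
  have a1 := mul_self_le_mul_self (abs_nonneg _) h1
  nlinarith

lemma coord_le_dist (x y : E2) (i : Fin 2) : |x i - y i| ≤ dist x y := by
  have := PiLp.norm_apply_le (x - y) i
  rw [dist_eq_norm]
  simpa using this

lemma dist_le_of_mem_cube {n : ℕ} {p : ℤ × ℤ} {x y : E2} (hx : x ∈ cube n p) (hy : y ∈ cube n p) :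
    dist x y ≤ 2 * (1 / 2) ^ n := by
  have hpos : (0:ℝ) < 2 ^ n := by positivity
  have key : ∀ s t : ℝ, ⌊(2:ℝ) ^ n * s⌋ = ⌊(2:ℝ) ^ n * t⌋ → |s - t| ≤ (1 / 2) ^ n := by
    intro s t h
    have := Int.abs_sub_lt_one_of_floor_eq_floor h
    rw [← mul_sub, abs_mul, abs_of_pos hpos] at this
    rw [one_div, inv_pow, ← one_div, le_div_iff₀ hpos]
    linarith
  have hxy : idx n x = idx n y := hx.trans hy.symm
  simp only [idx, Prod.mk.injEq] at hxy
  exact dist_le_of_coord (key _ _ hxy.1) (key _ _ hxy.2)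

/-- 3×3 block of indices around `p`. -/
noncomputable def nbr (p : ℤ × ℤ) : Finset (ℤ × ℤ) := Finset.Icc (p.1 - 1) (p.1 + 1) ×ˢ Finset.Icc (p.2 - 1) (p.2 + 1)

lemma card_nbr (p : ℤ × ℤ) : (nbr p).card = 9 := by
  simp only [nbr, Finset.card_product, Int.card_Icc]
  have : ∀ a : ℤ, (a + 1 + 1 - (a - 1)).toNat = 3 := by intro a; omega
  rw [this, this]

lemma ball_subset (n : ℕ) (x : E2) :
    Metric.closedBall x ((1/2) ^ n) ⊆ ⋃ q ∈ nbr (idx n x), cube n q := by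
  intro y hy
  simp only [Set.mem_iUnion]
  refine ⟨idx n y, ?_, rfl⟩
  have hpos : (0:ℝ) < 2 ^ n := by positivity
  have key : ∀ i, |(2:ℝ) ^ n * y i - 2 ^ n * x i| ≤ 1 := by
    intro i
    rw [← mul_sub, abs_mul, abs_of_pos hpos]
    have h := (coord_le_dist y x i).trans (Metric.mem_closedBall.mp hy)
    rw [one_div, inv_pow, ← one_div, le_div_iff₀ hpos] at h
    linarith
  have k2 : ∀ i, ⌊(2:ℝ) ^ n * y i⌋ ∈ Finset.Icc (⌊(2:ℝ) ^ n * x i⌋ - 1) (⌊(2:ℝ) ^ n * x i⌋ + 1) := by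
    intro i
    have := abs_le.mp (key i)
    rw [Finset.mem_Icc]
    constructor
    · rw [Int.le_floor]; push_cast
      have := Int.floor_le ((2:ℝ) ^ n * x i)
      linarith
    · rw [← Int.lt_add_one_iff, Int.floor_lt]; push_cast
      have := Int.lt_floor_add_one ((2:ℝ) ^ n * x i)
      linarith
  simp only [nbr, idx, Finset.mem_product]
  exact ⟨k2 0, k2 1⟩

/-- open neighbourhood of a cube contained in its 3×3 block. -/
lemma exists_open_nbhd (n : ℕ) (p : ℤ × ℤ) : ∃ O : Set E2, IsOpen O ∧ cube n p ⊆ O ∧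
    O ⊆ ⋃ q ∈ nbr p, cube n q := by
  refine ⟨⋃ x ∈ cube n p, Metric.ball x ((1/2) ^ n), isOpen_biUnion fun _ _ => Metric.isOpen_ball,
    fun x hx => Set.mem_biUnion hx (Metric.mem_ball_self (by positivity)), ?_⟩
  refine Set.iUnion₂_subset fun x hx => ?_
  have := ball_subset n x
  rw [mem_cube.mp hx] at this
  exact Metric.ball_subset_closedBall.trans this

/-! ### content -/

noncomputable def pre (β : ℝ≥0∞) (s : Set E2) : ℝ≥0∞ :=
  ⨅ (c : ℕ × (ℤ × ℤ)) (_ : s ⊆ cube c.1 c.2), β ^ c.1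

lemma pre_empty {β : ℝ≥0∞} (hβ : β < 1) : pre β ∅ = 0 := by
  have h : ∀ n : ℕ, pre β ∅ ≤ β ^ n := fun n =>
    iInf₂_le_of_le (n, (0, 0)) (Set.empty_subset _) le_rfl
  exact le_antisymm (ge_of_tendsto' (ENNReal.tendsto_pow_atTop_nhds_zero_of_lt_one hβ) h) bot_le

noncomputable def M (β : ℝ≥0∞) (hβ : β < 1) : OuterMeasure E2 :=
  OuterMeasure.ofFunction (pre β) (pre_empty hβ)

variable {β : ℝ≥0∞} {hβ : β < 1}

lemma M_cube_le (n : ℕ) (p : ℤ × ℤ) : M β hβ (cube n p) ≤ β ^ n :=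
  (OuterMeasure.ofFunction_le _).trans (iInf₂_le_of_le (n, p) le_rfl le_rfl)

lemma M_inter_cube_le (E : Set E2) (n : ℕ) (p : ℤ × ℤ) : M β hβ (E ∩ cube n p) ≤ β ^ n :=
  (measure_mono Set.inter_subset_right).trans (M_cube_le n p)

lemma exists_cover {E : Set E2} {c : ℝ≥0∞} (h : M β hβ E < c) :
    ∃ l : ℕ → ℕ × (ℤ × ℤ), E ⊆ ⋃ i, cube (l i).1 (l i).2 ∧ ∑' i, β ^ (l i).1 < c := by
  rw [M, OuterMeasure.ofFunction_apply] at h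
  simp only [iInf_lt_iff] at h
  obtain ⟨t, ht, hs⟩ := h
  obtain ⟨ε, hε, hεs⟩ := ENNReal.exists_pos_sum_of_countable' (tsub_pos_of_lt hs).ne' ℕ
  have hfin : ∀ i, pre β (t i) ≠ ∞ := fun i =>
    ((ENNReal.le_tsum i).trans_lt (hs.trans_le le_top)).ne
  have hch : ∀ i, ∃ l : ℕ × (ℤ × ℤ), t i ⊆ cube l.1 l.2 ∧ β ^ l.1 < pre β (t i) + ε i := by
    intro i
    have : pre β (t i) < pre β (t i) + ε i := ENNReal.lt_add_right (hfin i) (hε i).ne'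
    conv_lhs at this => rw [pre]
    simp only [iInf_lt_iff] at this
    obtain ⟨l, hl, hl2⟩ := this
    exact ⟨l, hl, hl2⟩
  choose l hl hl2 using hch
  refine ⟨l, ht.trans (Set.iUnion_mono hl), ?_⟩
  calc ∑' i, β ^ (l i).1 ≤ ∑' i, (pre β (t i) + ε i) := ENNReal.tsum_le_tsum fun i => (hl2 i).le
    _ = ∑' i, pre β (t i) + ∑' i, ε i := ENNReal.tsum_add
    _ < ∑' i, pre β (t i) + (c - ∑' i, pre β (t i)) :=
        ENNReal.add_lt_add_left (hs.trans_le le_top).ne hεs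
    _ = c := add_tsub_cancel_of_le hs.le

lemma cube_subset_ch (n : ℕ) (p : ℤ × ℤ) : cube n p ⊆ ⋃ q ∈ ch p, cube (n + 1) q := by
  intro x hx
  simp only [Set.mem_iUnion]
  exact ⟨idx (n+1) x, mem_ch.mpr ((par_idx n x).trans hx), rfl⟩

lemma M_le_ch (E : Set E2) (n : ℕ) (p : ℤ × ℤ) :
    M β hβ (E ∩ cube n p) ≤ ∑ q ∈ ch p, M β hβ (E ∩ cube (n + 1) q) := by
  refine le_trans (measure_mono ?_) (measure_biUnion_finset_le (ch p) fun q => E ∩ cube (n+1) q)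
  rintro x ⟨hx, hx2⟩
  have := cube_subset_ch n p hx2
  simp only [Set.mem_iUnion] at this ⊢
  obtain ⟨q, hq, h⟩ := this
  exact ⟨q, hq, hx, h⟩

/-- A smaller cube meets at most one cube of level `n`. -/
lemma sum_inter_le {μ : OuterMeasure E2} (I : Finset (ℤ × ℤ)) {n m : ℕ} (h : n ≤ m) (r : ℤ × ℤ) :
    ∑ q ∈ I, μ (cube n q ∩ cube m r) ≤ μ (cube m r) := by
  rcases (cube m r).eq_empty_or_nonempty with he | ⟨x, hx⟩
  · simp [he]
  · calc ∑ q ∈ I, μ (cube n q ∩ cube m r)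
        ≤ ∑ q ∈ I, if q = idx n x then μ (cube m r) else 0 := by
          refine Finset.sum_le_sum fun q _ => ?_
          split_ifs with hq
          · exact measure_mono Set.inter_subset_right
          · have : cube n q ∩ cube m r = ∅ := by
              rw [Set.eq_empty_iff_forall_notMem]
              rintro y ⟨hy, hy2⟩
              exact hq (hy.symm.trans (idx_mono h (hy2.trans hx.symm)))
            simp [this]
      _ ≤ μ (cube m r) := by
          rw [Finset.sum_ite_eq']
          split_ifs <;> simp

lemma M_ch_le (E : Set E2) (n : ℕ) (p : ℤ × ℤ) (h : M β hβ (E ∩ cube n p) < β ^ n) :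
    ∑ q ∈ ch p, M β hβ (E ∩ cube (n + 1) q) ≤ M β hβ (E ∩ cube n p) := by
  refine le_of_forall_gt_imp_ge_of_dense fun c hc => ?_
  obtain ⟨l, hl, hls⟩ := exists_cover (lt_min hc h)
  have hlev : ∀ i, n + 1 ≤ (l i).1 := by
    intro i
    by_contra hcon
    have h1 : β ^ n ≤ β ^ (l i).1 := pow_le_pow_right_of_le_one' hβ.le (by omega)
    have h2 : β ^ (l i).1 ≤ ∑' i, β ^ (l i).1 := ENNReal.le_tsum i
    exact absurd (h1.trans h2) (not_le.mpr (hls.trans_le (min_le_right _ _)))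
  calc ∑ q ∈ ch p, M β hβ (E ∩ cube (n + 1) q)
      ≤ ∑ q ∈ ch p, ∑' i, M β hβ (cube (n + 1) q ∩ cube (l i).1 (l i).2) := by
        refine Finset.sum_le_sum fun q hq => ?_
        refine le_trans (measure_mono ?_) (measure_iUnion_le _)
        rintro x ⟨hx, hx2⟩
        have hxn : x ∈ cube n p := by
          rw [mem_cube, ← par_idx, mem_cube.mp hx2]; exact mem_ch.mp hq
        have := hl ⟨hx, hxn⟩
        simp only [Set.mem_iUnion] at this ⊢
        obtain ⟨i, hi⟩ := this
        exact ⟨i, hx2, hi⟩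
    _ = ∑' i, ∑ q ∈ ch p, M β hβ (cube (n + 1) q ∩ cube (l i).1 (l i).2) :=
        (Summable.tsum_finsetSum fun _ _ => ENNReal.summable).symm
    _ ≤ ∑' i, β ^ (l i).1 := ENNReal.tsum_le_tsum fun i =>
        (sum_inter_le _ (hlev i) _).trans (M_cube_le _ _)
    _ ≤ c := (hls.trans_le (min_le_left _ _)).le

lemma M_inc_aux (E : ℕ → Set E2) (hE : Monotone E) (p₀ : ℤ × ℤ) (hsub : ∀ k, E k ⊆ cube 0 p₀)
    (t u : ℝ≥0∞) (htu : t + u = 1) (hu : u ≠ 0) :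
    t * M β hβ (⋃ k, E k) ≤ ⨆ k, M β hβ (E k) := by
  classical
  have hu1 : u ≠ ∞ := ne_top_of_le_ne_top ENNReal.one_ne_top (htu ▸ le_add_self)
  have ht1 : t ≤ 1 := htu ▸ le_self_add
  set V : ℕ → ℤ × ℤ → ℝ≥0∞ := fun n p => ⨆ k, M β hβ (E k ∩ cube n p) with hV
  have hV0 : V 0 p₀ = ⨆ k, M β hβ (E k) := by
    simp only [hV]
    congr 1; ext k
    rw [Set.inter_eq_left.mpr (hsub k)]
  rw [← hV0]
  have hVmono : ∀ n p, Monotone fun k => M β hβ (E k ∩ cube n p) := fun n p i j hij =>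
    measure_mono (Set.inter_subset_inter_left _ (hE hij))
  set Sat : ℕ → ℤ × ℤ → Prop := fun n p => t * β ^ n ≤ V n p with hSat
  -- superadditivity
  have hsup : ∀ n p, ¬ Sat n p → ∑ q ∈ ch p, V (n + 1) q ≤ V n p := by
    intro n p hn
    simp only [hSat, not_le] at hn
    have h1 : V n p < β ^ n := hn.trans_le (mul_le_of_le_one_left' ht1)
    simp only [hV]
    rw [ENNReal.finsetSum_iSup_of_monotone (fun q => hVmono (n+1) q)]
    refine iSup_mono fun k => M_ch_le _ _ _ ?_
    exact (le_iSup (fun k => M β hβ (E k ∩ cube n p)) k).trans_lt h1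
  let B : ℕ → Finset (ℤ × ℤ) := fun m => Nat.rec {p₀} (fun m b => (b.filter fun p => ¬ Sat m p).biUnion ch) m
  have hB0 : B 0 = {p₀} := rfl
  have hBs : ∀ m, B (m + 1) = ((B m).filter fun p => ¬ Sat m p).biUnion ch := fun m => rfl
  have hsum : ∀ N, ∑ m ∈ Finset.range N, ∑ q ∈ (B m).filter (Sat m), V m q + ∑ q ∈ B N, V N q ≤ V 0 p₀ := by
    intro N
    induction N with
    | zero => simp [hB0]
    | succ N ih =>
      refine le_trans ?_ ih
      rw [Finset.sum_range_succ, add_assoc]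
      gcongr
      rw [← Finset.sum_filter_add_sum_filter_not (B N) (Sat N) (V N)]
      gcongr
      rw [hBs, Finset.sum_biUnion]
      · refine Finset.sum_le_sum fun p hp => hsup N p (Finset.mem_filter.mp hp).2
      · intro p _ q _ hpq
        refine Finset.disjoint_left.mpr fun r hr hr2 => hpq ?_
        rw [← mem_ch.mp hr, mem_ch.mp hr2]
  have hsum2 : ∑' m, ∑ q ∈ (B m).filter (Sat m), t * β ^ m ≤ V 0 p₀ := by
    rw [ENNReal.tsum_eq_iSup_nat]
    refine iSup_le fun N => le_trans (Finset.sum_le_sum fun m _ => Finset.sum_le_sum fun q hq => ?_)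
      (le_self_add.trans (hsum N))
    exact (Finset.mem_filter.mp hq).2
  set R : Set E2 := {x | ∀ m, ¬ Sat m (idx m x)} with hR
  have hcov : (⋃ k, E k) ⊆ (⋃ m, ⋃ q ∈ (B m).filter (Sat m), cube m q) ∪ ⋃ k, (E k ∩ R) := by
    intro x hx
    obtain ⟨k, hk⟩ := Set.mem_iUnion.mp hx
    by_cases hxR : x ∈ R
    · exact Or.inr (Set.mem_iUnion.mpr ⟨k, hk, hxR⟩)
    · left
      by_contra hcon
      have hall : ∀ m, idx m x ∈ B m ∧ ¬ Sat m (idx m x) := by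
        have key : ∀ m, idx m x ∈ B m → ¬ Sat m (idx m x) := by
          intro m hm hs
          apply hcon
          simp only [Set.mem_iUnion]
          exact ⟨m, idx m x, Finset.mem_filter.mpr ⟨hm, hs⟩, rfl⟩
        intro m
        induction m with
        | zero =>
          have : idx 0 x ∈ B 0 := by rw [hB0, Finset.mem_singleton]; exact hsub k hk
          exact ⟨this, key _ this⟩
        | succ m ih =>
          have : idx (m+1) x ∈ B (m+1) := by
            rw [hBs, Finset.mem_biUnion]
            exact ⟨idx m x, Finset.mem_filter.mpr ih, mem_ch.mpr (par_idx m x)⟩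
          exact ⟨this, key _ this⟩
      exact hxR fun m => (hall m).2
  have hR0 : ∀ k, M β hβ (E k ∩ R) = 0 := by
    intro k
    have hfin : M β hβ (E k) ≠ ∞ := by
      refine ne_top_of_le_ne_top ENNReal.one_ne_top ?_
      have := (measure_mono (hsub k)).trans (M_cube_le (hβ := hβ) 0 p₀)
      simpa using this
    have hδ : ∀ δ : ℝ≥0∞, δ ≠ 0 → u * M β hβ (E k ∩ R) ≤ δ := by
      intro δ hδ
      obtain ⟨l, hl, hls⟩ := exists_cover (ENNReal.lt_add_right hfin hδ)
      set c : ℕ → ℝ≥0∞ := fun i => M β hβ (E k ∩ R ∩ cube (l i).1 (l i).2) with hc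
      have h1 : M β hβ (E k ∩ R) ≤ ∑' i, c i := by
        refine le_trans (measure_mono ?_) (measure_iUnion_le _)
        intro x hx
        obtain ⟨i, hi⟩ := Set.mem_iUnion.mp (hl hx.1)
        exact Set.mem_iUnion.mpr ⟨i, hx, hi⟩
      have h2 : M β hβ (E k) ≤ ∑' i, M β hβ (E k ∩ cube (l i).1 (l i).2) := by
        refine le_trans (measure_mono ?_) (measure_iUnion_le _)
        intro x hx
        obtain ⟨i, hi⟩ := Set.mem_iUnion.mp (hl hx)
        exact Set.mem_iUnion.mpr ⟨i, hx, hi⟩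
      have h3 : M β hβ (E k) + u * M β hβ (E k ∩ R) ≤ M β hβ (E k) + δ := by
        calc M β hβ (E k) + u * M β hβ (E k ∩ R)
            ≤ ∑' i, M β hβ (E k ∩ cube (l i).1 (l i).2) + u * ∑' i, c i := by gcongr
          _ = ∑' i, (M β hβ (E k ∩ cube (l i).1 (l i).2) + u * c i) := by
              rw [← ENNReal.tsum_mul_left, ENNReal.tsum_add]
          _ ≤ ∑' i, β ^ (l i).1 := by
              refine ENNReal.tsum_le_tsum fun i => ?_
              rcases (E k ∩ R ∩ cube (l i).1 (l i).2).eq_empty_or_nonempty with he | ⟨x, ⟨_, hxR⟩, hx⟩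
              · simp only [hc, he, measure_empty, mul_zero, add_zero]
                exact M_inter_cube_le _ _ _
              · have h4 : M β hβ (E k ∩ cube (l i).1 (l i).2) ≤ t * β ^ (l i).1 := by
                  have := hxR (l i).1
                  rw [mem_cube.mp hx] at this
                  simp only [hSat, not_le] at this
                  exact (le_iSup (fun k => M β hβ (E k ∩ cube (l i).1 (l i).2)) k).trans this.le
                calc _ ≤ t * β ^ (l i).1 + u * β ^ (l i).1 := by
                      gcongr
                      exact M_inter_cube_le _ _ _
                  _ = β ^ (l i).1 := by rw [← add_mul, htu, one_mul]
          _ ≤ M β hβ (E k) + δ := hls.le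
      exact (ENNReal.add_le_add_iff_left hfin).mp h3
    have h0 : u * M β hβ (E k ∩ R) = 0 := by
      by_contra hne
      obtain ⟨δ, hδ0, hδ1⟩ := exists_between (pos_iff_ne_zero.mpr hne)
      exact absurd (hδ δ hδ0.ne') (not_le.mpr hδ1)
    exact (mul_eq_zero.mp h0).resolve_left hu
  have hfinal : M β hβ (⋃ k, E k) ≤ ∑' m, ∑ q ∈ (B m).filter (Sat m), β ^ m := by
    calc M β hβ (⋃ k, E k) ≤ _ := measure_mono hcov
      _ ≤ _ := measure_union_le _ _
      _ ≤ ∑' m, ∑ q ∈ (B m).filter (Sat m), β ^ m + 0 := by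
        gcongr
        · refine (measure_iUnion_le _).trans (ENNReal.tsum_le_tsum fun m => ?_)
          refine (measure_biUnion_finset_le _ _).trans (Finset.sum_le_sum fun q _ => M_cube_le _ _)
        · rw [nonpos_iff_eq_zero]
          exact measure_iUnion_null hR0
      _ = _ := add_zero _
  calc t * M β hβ (⋃ k, E k) ≤ t * ∑' m, ∑ q ∈ (B m).filter (Sat m), β ^ m := by gcongr
    _ = ∑' m, ∑ q ∈ (B m).filter (Sat m), t * β ^ m := by
      rw [← ENNReal.tsum_mul_left]
      simp only [Finset.mul_sum]
    _ ≤ _ := hsum2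

lemma M_inc (E : ℕ → Set E2) (hE : Monotone E) (p₀ : ℤ × ℤ) (hsub : ∀ k, E k ⊆ cube 0 p₀)
    {c : ℝ≥0∞} (hc : c < M β hβ (⋃ k, E k)) : ∃ k, c < M β hβ (E k) := by
  rw [← lt_iSup_iff]
  have hlim : Filter.Tendsto (fun n : ℕ => (1 - (n : ℝ≥0∞)⁻¹) * M β hβ (⋃ k, E k)) Filter.atTop
      (nhds ((1 - 0) * M β hβ (⋃ k, E k))) := by
    refine ENNReal.Tendsto.mul_const ?_ (Or.inl (by simp))
    exact ENNReal.Tendsto.sub tendsto_const_nhds ENNReal.tendsto_inv_nat_nhds_zero (by simp)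
  rw [tsub_zero, one_mul] at hlim
  obtain ⟨n, hn, hn1⟩ := ((hlim.eventually_const_lt hc).and (Filter.eventually_ge_atTop 1)).exists
  refine hn.trans_le (M_inc_aux E hE p₀ hsub _ (n : ℝ≥0∞)⁻¹ (tsub_add_cancel_of_le ?_) (by simp))
  rw [ENNReal.inv_le_one]; exact_mod_cast hn1

lemma compact_capture {X : Type*} [TopologicalSpace X] (f : (ℕ → ℕ) → X) (hf : Continuous f)
    (g : ℕ → ℕ) (W : Set X) (hW : IsOpen W) (hsub : f '' {x | ∀ i, x i ≤ g i} ⊆ W) :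
    ∃ k, f '' {x | ∀ i < k, x i ≤ g i} ⊆ W := by
  by_contra hcon
  push Not at hcon
  have hx : ∀ k, ∃ x : ℕ → ℕ, (∀ i < k, x i ≤ g i) ∧ f x ∉ W := by
    intro k
    have := hcon k
    rw [Set.not_subset] at this
    obtain ⟨_, ⟨x, hx, rfl⟩, h⟩ := this
    exact ⟨x, hx, h⟩
  choose x hx hxW using hx
  have hcomp : IsCompact {x : ℕ → ℕ | ∀ i, x i ≤ g i} := by
    have := isCompact_univ_pi (s := fun i => Set.Iic (g i)) fun i => (Set.finite_Iic (g i)).isCompact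
    convert this using 1
    ext x; simp [Pi.le_def]
  obtain ⟨y, hy, φ, hφ, hlim⟩ := hcomp.tendsto_subseq (x := fun k i => min (x k i) (g i))
    (fun k i => min_le_right _ _)
  have hlim2 : Filter.Tendsto (x ∘ φ) Filter.atTop (nhds y) := by
    rw [tendsto_pi_nhds] at hlim ⊢
    intro i
    refine (hlim i).congr' ?_
    filter_upwards [Filter.eventually_gt_atTop i] with k hk
    have : i < φ k := hk.trans_le hφ.le_apply
    simp [hx (φ k) i this]
  have hev := hlim2.eventually ((hW.preimage hf).mem_nhds (hsub ⟨y, hy, rfl⟩))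
  obtain ⟨k, hk⟩ := hev.exists
  exact hxW _ hk

lemma exists_bound_seq (f : (ℕ → ℕ) → E2) (p₀ : ℤ × ℤ) (hsub : Set.range f ⊆ cube 0 p₀)
    (c : ℝ≥0∞) (hc : c < M β hβ (Set.range f)) :
    ∃ g : ℕ → ℕ, ∀ k, c < M β hβ (f '' {x | ∀ i < k, x i ≤ g i}) := by
  have step : ∀ (k : ℕ) (A : Set (ℕ → ℕ)), c < M β hβ (f '' A) →
      ∃ n, c < M β hβ (f '' (A ∩ {x | x k ≤ n})) := by
    intro k A hA
    refine M_inc (fun n => f '' (A ∩ {x | x k ≤ n})) ?_ p₀ ?_ ?_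
    · intro i j hij
      refine Set.image_mono (Set.inter_subset_inter_right _ fun x hx => ?_)
      exact le_trans hx hij
    · intro n
      exact (Set.image_subset_range _ _).trans hsub
    · convert hA using 2
      rw [← Set.image_iUnion, ← Set.inter_iUnion]
      congr 1
      refine Set.inter_eq_left.mpr fun x _ => Set.mem_iUnion.mpr ⟨x k, le_refl (x k)⟩
  choose! N hN using step
  let A : ℕ → Set (ℕ → ℕ) := fun k => Nat.rec Set.univ (fun k A => A ∩ {x | x k ≤ N k A}) k
  have hA : ∀ k, c < M β hβ (f '' A k) := by
    intro k
    induction k with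
    | zero => simpa [A] using hc
    | succ k ih => exact hN k _ ih
  refine ⟨fun k => N k (A k), fun k => ?_⟩
  have : A k = {x | ∀ i < k, x i ≤ N i (A i)} := by
    induction k with
    | zero => simp [A]
    | succ k ih =>
      have h : A (k+1) = A k ∩ {x | x k ≤ N k (A k)} := rfl
      rw [h]
      conv_lhs => rw [ih]
      ext x
      simp only [Set.mem_inter_iff, Set.mem_ofPred_eq, Nat.lt_succ_iff_lt_or_eq]
      constructor
      · rintro ⟨h1, h2⟩ i (hi | rfl)
        · exact h1 i hi
        · rw [ih]; exact h2
      · intro h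
        refine ⟨fun i hi => h i (Or.inl hi), ?_⟩
        have := h k (Or.inr rfl)
        rw [ih] at this; exact this
  rw [← this]
  exact hA k

lemma exists_compact_subset (K : Set E2) (hK : MeasurableSet K) (hpos : M β hβ K ≠ 0) :
    ∃ C ⊆ K, ∃ p₀, IsCompact C ∧ C ⊆ cube 0 p₀ ∧ M β hβ C ≠ 0 := by
  obtain ⟨p₀, hp₀⟩ : ∃ p₀, M β hβ (K ∩ cube 0 p₀) ≠ 0 := by
    by_contra hcon
    push Not at hcon
    apply hpos
    have : K ⊆ ⋃ p, K ∩ cube 0 p := fun x hx => Set.mem_iUnion.mpr ⟨idx 0 x, hx, rfl⟩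
    exact measure_mono_null this (measure_iUnion_null hcon)
  have han := (hK.inter (measurableSet_cube 0 p₀)).analyticSet
  rw [AnalyticSet] at han
  rcases han with he | ⟨f, hf, hr⟩
  · rw [he] at hp₀; simp at hp₀
  rw [← hr] at hp₀
  obtain ⟨c, hc0, hc⟩ := exists_between (pos_iff_ne_zero.mpr hp₀)
  have hfsub : Set.range f ⊆ cube 0 p₀ := hr ▸ Set.inter_subset_right
  obtain ⟨g, hg⟩ := exists_bound_seq f p₀ hfsub c hc
  have hcomp : IsCompact {x : ℕ → ℕ | ∀ i, x i ≤ g i} := by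
    have := isCompact_univ_pi (s := fun i => Set.Iic (g i)) fun i => (Set.finite_Iic (g i)).isCompact
    convert this using 1
    ext x; simp [Pi.le_def]
  refine ⟨f '' {x | ∀ i, x i ≤ g i}, ?_, p₀, hcomp.image hf, ?_, ?_⟩
  · exact (Set.image_subset_range _ _).trans (hr ▸ Set.inter_subset_left)
  · exact (Set.image_subset_range _ _).trans hfsub
  · intro h0
    have h9 : (0:ℝ≥0∞) < c / 9 := ENNReal.div_pos hc0.ne' (by simp)
    obtain ⟨l, hl, hls⟩ := exists_cover (hβ := hβ) (h0.trans_lt h9)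
    choose O hO hO1 hO2 using exists_open_nbhd
    obtain ⟨k, hk⟩ := compact_capture f hf g (⋃ i, O (l i).1 (l i).2) (isOpen_iUnion fun i => hO _ _)
      (hl.trans (Set.iUnion_mono fun i => hO1 _ _))
    have : M β hβ (f '' {x | ∀ i < k, x i ≤ g i}) ≤ c := by
      calc _ ≤ M β hβ (⋃ i, O (l i).1 (l i).2) := measure_mono hk
        _ ≤ ∑' i, M β hβ (O (l i).1 (l i).2) := measure_iUnion_le _
        _ ≤ ∑' i, 9 * β ^ (l i).1 := by
          refine ENNReal.tsum_le_tsum fun i => ?_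
          refine (measure_mono (hO2 _ _)).trans ((measure_biUnion_finset_le _ _).trans ?_)
          refine (Finset.sum_le_card_nsmul _ _ _ fun q _ => M_cube_le _ q).trans ?_
          rw [card_nbr]; simp
        _ = 9 * ∑' i, β ^ (l i).1 := ENNReal.tsum_mul_left
        _ ≤ 9 * (c / 9) := by gcongr
        _ = c := ENNReal.mul_div_cancel (by simp) (by simp)
    exact absurd this (not_le.mpr (hg k))

/-- finite-scale Frostman lemma -/
lemma frostman (C : Set E2) (j : ℕ) : ∀ (n : ℕ) (p : ℤ × ℤ) (a : ℝ≥0∞), a ≤ M β hβ (C ∩ cube n p) →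
    ∃ μ : Measure E2, μ Set.univ = a ∧ μ (cube n p)ᶜ = 0 ∧ (∀ B, C ⊆ B → MeasurableSet B → μ Bᶜ = 0) ∧
      ∀ i ≤ j, ∀ q, μ (cube (n + i) q) ≤ β ^ (n + i) := by
  induction j with
  | zero =>
    intro n p a ha
    by_cases ha0 : a = 0
    · exact ⟨0, by simp [ha0], by simp, by simp, by simp⟩
    have hne : (C ∩ cube n p).Nonempty := by
      by_contra h
      rw [Set.not_nonempty_iff_eq_empty] at h
      rw [h] at ha
      simp at ha; exact ha0 ha
    obtain ⟨x, hxC, hx⟩ := hne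
    refine ⟨a • Measure.dirac x, by simp, ?_, ?_, ?_⟩
    · simp [Measure.dirac_apply' _ (measurableSet_cube n p).compl, hx]
    · intro B hB hBm
      simp [Measure.dirac_apply' _ hBm.compl, hB hxC]
    · intro i hi q
      obtain rfl : i = 0 := by omega
      refine le_trans (measure_mono (Set.subset_univ _)) ?_
      simpa using ha.trans (M_inter_cube_le _ _ _)
  | succ j ih =>
    intro n p a ha
    set v : ℤ × ℤ → ℝ≥0∞ := fun q => M β hβ (C ∩ cube (n+1) q) with hv
    have hav : a ≤ ∑ q ∈ ch p, v q := ha.trans (M_le_ch _ _ _)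
    have hfin : ∑ q ∈ ch p, v q ≠ ∞ := by
      refine (ENNReal.sum_lt_top.mpr fun q _ => ?_).ne
      exact ((M_inter_cube_le _ _ _).trans (pow_le_one' hβ.le _)).trans_lt ENNReal.one_lt_top
    obtain ⟨b, hb1, hb2⟩ : ∃ b : ℤ × ℤ → ℝ≥0∞, (∀ q, b q ≤ v q) ∧ ∑ q ∈ ch p, b q = a := by
      by_cases h0 : ∑ q ∈ ch p, v q = 0
      · refine ⟨0, by simp, ?_⟩
        rw [h0] at hav
        simp at hav ⊢; exact hav.symm
      · refine ⟨fun q => a / (∑ q ∈ ch p, v q) * v q, fun q => ?_, ?_⟩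
        · exact mul_le_of_le_one_left' (ENNReal.div_le_of_le_mul (by simpa using hav))
        · rw [← Finset.mul_sum, ENNReal.div_mul_cancel h0 hfin]
    choose μ h1 h2 h3 h4 using fun q => ih (n+1) q (b q) (hb1 q)
    refine ⟨∑ q ∈ ch p, μ q, ?_, ?_, ?_, ?_⟩
    · simp [h1, hb2]
    · simp only [Measure.coe_finsetSum, Finset.sum_apply, Finset.sum_eq_zero_iff]
      intro q hq
      refine measure_mono_null (Set.compl_subset_compl.mpr ?_) (h2 q)
      intro x hx
      rw [mem_cube, ← par_idx, mem_cube.mp hx]; exact mem_ch.mp hq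
    · intro B hB hBm
      simp only [Measure.coe_finsetSum, Finset.sum_apply, Finset.sum_eq_zero_iff]
      intro q hq
      exact h3 q B hB hBm
    · intro i hi r
      rcases i with _ | i
      · refine le_trans (measure_mono (Set.subset_univ _)) ?_
        simp only [Measure.coe_finsetSum, Finset.sum_apply, h1, hb2]
        simpa using ha.trans (M_inter_cube_le _ _ _)
      · simp only [Measure.coe_finsetSum, Finset.sum_apply]
        have e : n + (i + 1) = n + 1 + i := by ring
        rw [e]
        rcases (cube (n+1+i) r).eq_empty_or_nonempty with he | ⟨x, hx⟩
        · simp [he]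
        calc ∑ q ∈ ch p, μ q (cube (n+1+i) r)
            ≤ ∑ q ∈ ch p, if q = idx (n+1) x then β ^ (n+1+i) else 0 := by
              refine Finset.sum_le_sum fun q _ => ?_
              split_ifs with hq
              · exact h4 q i (by omega) r
              · refine le_of_eq (measure_mono_null ?_ (h2 q))
                intro y hy hyq
                exact hq (hyq.symm.trans (idx_mono (by omega) (hy.trans hx.symm)))
          _ ≤ β ^ (n+1+i) := by
              rw [Finset.sum_ite_eq']
              split_ifs <;> simp

/-- Null content implies null Hausdorff measure. -/
lemma hausdorff_null (s : ℝ) (hs : 0 < s) (hβs : β = ENNReal.ofReal ((1/2 : ℝ) ^ s)) (K : Set E2)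
    (h0 : M β hβ K = 0) : μH[s] K = 0 := by
  have hcov : ∀ j : ℕ, ∃ l : ℕ → ℕ × (ℤ × ℤ), K ⊆ ⋃ i, cube (l i).1 (l i).2 ∧
      ∑' i, β ^ (l i).1 < ((j : ℝ≥0∞) + 1)⁻¹ := by
    intro j
    apply exists_cover (hβ := hβ)
    rw [h0]; simp
  choose l hl hls using hcov
  have hinv : Filter.Tendsto (fun j : ℕ => ((j : ℝ≥0∞) + 1)⁻¹) Filter.atTop (nhds 0) := by
    have := (Filter.tendsto_add_atTop_iff_nat 1).mpr ENNReal.tendsto_inv_nat_nhds_zero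
    simpa using this
  have hdiam : ∀ n p, Metric.ediam (cube n p) ^ s ≤ (2:ℝ≥0∞) ^ s * β ^ n := by
    intro n p
    have h1 : Metric.ediam (cube n p) ≤ ENNReal.ofReal (2 * (1/2) ^ n) := by
      refine Metric.ediam_le fun x hx y hy => ?_
      rw [edist_dist]
      exact ENNReal.ofReal_le_ofReal (dist_le_of_mem_cube hx hy)
    calc _ ≤ ENNReal.ofReal (2 * (1/2) ^ n) ^ s := by gcongr
      _ = _ := by
        rw [ENNReal.ofReal_mul (by norm_num), ENNReal.mul_rpow_of_nonneg _ _ hs.le, hβs,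
          ← ENNReal.ofReal_pow (by positivity), ENNReal.ofReal_rpow_of_nonneg (x := (1/2)^n) (by positivity) hs.le]
        congr 2
        · simp
        · rw [← Real.rpow_natCast, ← Real.rpow_natCast, ← Real.rpow_mul (by norm_num), ← Real.rpow_mul (by norm_num), mul_comm]
  have hd2 : ∀ j i, Metric.ediam (cube (l j i).1 (l j i).2) ≤ ((2:ℝ≥0∞) ^ s * ((j : ℝ≥0∞) + 1)⁻¹) ^ (1/s) := by
    intro j i
    rw [one_div, ENNReal.le_rpow_inv_iff hs]
    refine (hdiam _ _).trans ?_
    gcongr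
    exact (ENNReal.le_tsum (f := fun i => β ^ (l j i).1) i).trans (hls j).le
  have h2s : (2:ℝ≥0∞) ^ s ≠ ∞ := ENNReal.rpow_ne_top_of_nonneg hs.le (by simp)
  have hlim : Filter.Tendsto (fun j : ℕ => (2:ℝ≥0∞) ^ s * ((j : ℝ≥0∞) + 1)⁻¹) Filter.atTop (nhds 0) := by
    have := ENNReal.Tendsto.const_mul hinv (a := (2:ℝ≥0∞) ^ s) (Or.inr h2s)
    simpa using this
  have hlim2 : Filter.Tendsto (fun j : ℕ => ((2:ℝ≥0∞) ^ s * ((j : ℝ≥0∞) + 1)⁻¹) ^ (1/s)) Filter.atTop (nhds 0) := by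
    have := hlim.ennrpow_const (1/s)
    rwa [ENNReal.zero_rpow_of_pos (by positivity)] at this
  have := Measure.hausdorffMeasure_le_liminf_tsum s K _ hlim2 (fun j i => cube (l j i).1 (l j i).2)
    (Filter.Eventually.of_forall hd2) (Filter.Eventually.of_forall hl)
  refine le_antisymm (this.trans ?_) bot_le
  refine le_of_le_of_eq (Filter.liminf_le_liminf (v := fun j : ℕ => (2:ℝ≥0∞) ^ s * ((j : ℝ≥0∞) + 1)⁻¹) (Filter.Eventually.of_forall fun j => ?_)) hlim.liminf_eq
  calc _ ≤ ∑' i, (2:ℝ≥0∞) ^ s * β ^ (l j i).1 := ENNReal.tsum_le_tsum fun i => hdiam _ _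
    _ = (2:ℝ≥0∞) ^ s * ∑' i, β ^ (l j i).1 := ENNReal.tsum_mul_left
    _ ≤ _ := by gcongr; exact (hls j).le

lemma two_mul_le (a b : ℝ≥0∞) : 2 * a * b ≤ a ^ 2 + b ^ 2 := by
  rcases le_total a b with h | h
  · obtain ⟨c, rfl⟩ := exists_add_of_le h
    refine le_of_le_of_eq (b := 2 * a * (a + c) + c ^ 2) le_self_add (by ring)
  · obtain ⟨c, rfl⟩ := exists_add_of_le h
    refine le_of_le_of_eq (b := 2 * (b + c) * b + c ^ 2) le_self_add (by ring)

/-- Cauchy–Schwarz at scale `r`. -/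
lemma cs (ν : Measure ℝ) [IsFiniteMeasure ν] (B : Set ℝ) (hB : ν Bᶜ = 0) (r : ℝ) (hr : 0 < r)
    (a : ℝ≥0∞) :
    2 * a * ν Set.univ ≤ (ν.prod ν) {z | |z.1 - z.2| ≤ 2 * r} / ENNReal.ofReal (2 * r) +
      a ^ 2 * volume (Metric.cthickening r B) := by
  set d := ENNReal.ofReal (2 * r) with hd
  have hd0 : d ≠ 0 := by simp [hd, hr]
  have hdt : d ≠ ∞ := ENNReal.ofReal_ne_top
  set φ : ℝ → ℝ≥0∞ := fun t => ν (Metric.closedBall t r) with hφ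
  have hmS : MeasurableSet {z : ℝ × ℝ | |z.1 - z.2| ≤ r} :=
    (isClosed_le (by fun_prop) (by fun_prop)).measurableSet
  have hφm : Measurable φ := by
    have := measurable_measure_prodMk_left (ν := ν) hmS
    convert this using 3 with t
    ext x; simp [Real.dist_eq, abs_sub_comm]
  have h1 : ∫⁻ t, φ t = d * ν Set.univ := by
    have e1 : (volume.prod ν) {z : ℝ × ℝ | |z.1 - z.2| ≤ r} = ∫⁻ t, φ t := by
      rw [Measure.prod_apply hmS]
      congr 1; ext t; congr 1; ext x; simp [Real.dist_eq, abs_sub_comm]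
    have e2 : (volume.prod ν) {z : ℝ × ℝ | |z.1 - z.2| ≤ r} = ∫⁻ x, volume (Metric.closedBall x r) ∂ν := by
      rw [Measure.prod_apply_symm hmS]
      congr 1
    rw [← e1, e2]
    simp [hd]
  have h2 : ∫⁻ t, φ t ^ 2 ≤ d * (ν.prod ν) {z | |z.1 - z.2| ≤ 2 * r} := by
    set S : Set (ℝ × (ℝ × ℝ)) := {z | |z.2.1 - z.1| ≤ r ∧ |z.2.2 - z.1| ≤ r} with hS
    have hSm : MeasurableSet S :=
      ((isClosed_le (f := fun z : ℝ × (ℝ × ℝ) => |z.2.1 - z.1|) (g := fun _ => r) (by fun_prop)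
        (by fun_prop)).inter (isClosed_le (f := fun z : ℝ × (ℝ × ℝ) => |z.2.2 - z.1|)
        (g := fun _ => r) (by fun_prop) (by fun_prop))).measurableSet
    have hDm : MeasurableSet {z : ℝ × ℝ | |z.1 - z.2| ≤ 2 * r} :=
      (isClosed_le (by fun_prop) (by fun_prop)).measurableSet
    have e1 : (volume.prod (ν.prod ν)) S = ∫⁻ t, φ t ^ 2 := by
      rw [Measure.prod_apply hSm]
      congr 1; ext t
      rw [hφ, sq, ← Measure.prod_prod]
      congr 1
    rw [← e1, Measure.prod_apply_symm hSm]
    calc _ ≤ ∫⁻ z, Set.indicator {z : ℝ × ℝ | |z.1 - z.2| ≤ 2 * r} (fun _ => d) z ∂(ν.prod ν) := by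
          refine lintegral_mono fun z => ?_
          by_cases hz : |z.1 - z.2| ≤ 2 * r
          · rw [Set.indicator_of_mem (show z ∈ {z : ℝ × ℝ | |z.1 - z.2| ≤ 2 * r} from hz)]
            calc volume ((fun x => (x, z)) ⁻¹' S) ≤ volume (Metric.closedBall z.1 r) := by
                  refine measure_mono fun t ht => ?_
                  rw [Metric.mem_closedBall, dist_comm, Real.dist_eq]; exact ht.1
              _ = d := by simp [hd]
          · have : (fun x => (x, z)) ⁻¹' S = ∅ := by
              rw [Set.eq_empty_iff_forall_notMem]
              rintro t ⟨h1, h2⟩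
              apply hz
              simp only at h1 h2
              rw [abs_le] at *
              constructor <;> linarith
            simp [this]
      _ = _ := by rw [lintegral_indicator_const hDm]
  have hA : MeasurableSet (Metric.cthickening r B) := Metric.isClosed_cthickening.measurableSet
  have hφ0 : ∀ t, t ∉ Metric.cthickening r B → φ t = 0 := by
    intro t ht
    refine measure_mono_null (show Metric.closedBall t r ⊆ Bᶜ from fun x hx hxB => ht ?_) hB
    exact Metric.mem_cthickening_of_dist_le t x r B hxB (by rw [dist_comm]; exact hx)
  have h3 : 2 * a * d * (d * ν Set.univ) ≤ d * (ν.prod ν) {z | |z.1 - z.2| ≤ 2 * r} +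
      (a * d) ^ 2 * volume (Metric.cthickening r B) := by
    calc 2 * a * d * (d * ν Set.univ) = ∫⁻ t, 2 * a * d * φ t := by
          rw [lintegral_const_mul _ hφm, h1]
      _ ≤ ∫⁻ t, (φ t ^ 2 + (Metric.cthickening r B).indicator (fun _ => (a * d) ^ 2) t) := by
          refine lintegral_mono fun t => ?_
          by_cases ht : t ∈ Metric.cthickening r B
          · rw [Set.indicator_of_mem ht, add_comm]
            simpa [mul_assoc] using two_mul_le (a * d) (φ t)
          · simp [hφ0 t ht]
      _ = (∫⁻ t, φ t ^ 2) + (a * d) ^ 2 * volume (Metric.cthickening r B) := by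
          rw [lintegral_add_left (hφm.pow_const 2), lintegral_indicator_const hA]
      _ ≤ _ := by gcongr
  have hdd : d ^ 2 ≠ 0 := pow_ne_zero 2 hd0
  have hddt : d ^ 2 ≠ ∞ := ENNReal.pow_ne_top hdt
  rw [← ENNReal.mul_le_mul_iff_right hdd hddt]
  calc d ^ 2 * (2 * a * ν Set.univ) = 2 * a * d * (d * ν Set.univ) := by ring
    _ ≤ _ := h3
    _ = d * (d * ((ν.prod ν) {z | |z.1 - z.2| ≤ 2 * r} / d)) + (a * d) ^ 2 * volume (Metric.cthickening r B) := by
      rw [ENNReal.mul_div_cancel hd0 hdt]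
    _ = _ := by ring

noncomputable def pr (θ : ℝ) (v : E2) : ℝ := Real.cos θ * v 0 + Real.sin θ * v 1

lemma norm_E2 (u : E2) : ‖(⟨u 0, u 1⟩ : ℂ)‖ = ‖u‖ := by
  rw [EuclideanSpace.norm_eq, Complex.norm_def, Complex.normSq_mk]
  congr 1
  simp [Fin.sum_univ_two, sq]

lemma angular_core (T : ℕ) (u : E2) (hu : u ≠ 0) (δ : ℝ) :
    volume ({θ : ℝ | |pr θ u| ≤ δ} ∩ Set.Icc (-(T:ℝ)) T) ≤
      ENNReal.ofReal ((2 * T + 5) * Real.pi * (δ / ‖u‖)) := by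
  have hρ : 0 < ‖u‖ := norm_pos_iff.mpr hu
  set z : ℂ := ⟨u 0, u 1⟩ with hz
  set φ := Complex.arg z with hφ
  have hzn : ‖z‖ = ‖u‖ := norm_E2 u
  have h0 : u 0 = ‖u‖ * Real.cos φ := by
    rw [← hzn, Complex.norm_mul_cos_arg]
  have h1 : u 1 = ‖u‖ * Real.sin φ := by
    rw [← hzn, Complex.norm_mul_sin_arg]
  set η := δ / ‖u‖ with hη
  have hpi := Real.pi_pos
  have hpi3 := Real.pi_gt_three
  have hsub : {θ : ℝ | |pr θ u| ≤ δ} ∩ Set.Icc (-(T:ℝ)) T ⊆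
      ⋃ k ∈ Finset.Icc (-((T:ℤ) + 2)) (T + 2), Metric.closedBall (φ + Real.pi / 2 + k * Real.pi) (Real.pi * η / 2) := by
    rintro θ ⟨hθ, hT1, hT2⟩
    have hcos : |Real.cos (θ - φ)| ≤ η := by
      rw [hη, le_div_iff₀ hρ]
      have : pr θ u = Real.cos (θ - φ) * ‖u‖ := by
        rw [pr, h0, h1, Real.cos_sub]; ring
      have h2 : |pr θ u| ≤ δ := hθ
      rwa [this, abs_mul, abs_norm] at h2
    set k := round ((θ - φ - Real.pi / 2) / Real.pi) with hk
    have hr := abs_sub_round ((θ - φ - Real.pi / 2) / Real.pi)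
    rw [← hk] at hr
    set y := θ - φ - Real.pi / 2 - k * Real.pi with hy
    have hy2 : |y| ≤ Real.pi / 2 := by
      have : y = ((θ - φ - Real.pi / 2) / Real.pi - k) * Real.pi := by
        rw [hy]; field_simp
      rw [this, abs_mul, abs_of_pos hpi]
      nlinarith
    have hsin : |Real.sin y| = |Real.cos (θ - φ)| := by
      have : θ - φ = y + Real.pi / 2 + k * Real.pi := by rw [hy]; ring
      rw [this, Real.cos_add_int_mul_pi, abs_mul, Real.cos_add_pi_div_two, abs_neg]
      simp
    have hfin := Real.mul_abs_le_abs_sin hy2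
    simp only [Set.mem_iUnion]
    refine ⟨k, ?_, ?_⟩
    · have hφ1 := Complex.neg_pi_lt_arg z
      have hφ2 := Complex.arg_le_pi z
      rw [← hφ] at hφ1 hφ2
      rw [abs_le] at hy2
      have hTn : (0:ℝ) ≤ T := Nat.cast_nonneg T
      have a1 : (k:ℝ) * Real.pi < (T + 3) * Real.pi := by nlinarith
      have a2 : (-(T + 3) : ℝ) * Real.pi < k * Real.pi := by nlinarith
      have b1 := lt_of_mul_lt_mul_right a1 hpi.le
      have b2 := lt_of_mul_lt_mul_right a2 hpi.le
      have c1 : k < (T:ℤ) + 3 := by exact_mod_cast b1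
      have c2 : -((T:ℤ) + 3) < k := by exact_mod_cast b2
      rw [Finset.mem_Icc]
      omega
    · rw [Metric.mem_closedBall, Real.dist_eq]
      have : θ - (φ + Real.pi / 2 + k * Real.pi) = y := by rw [hy]; ring
      rw [this]
      rw [hsin] at hfin
      have h3 := hfin.trans hcos
      rw [div_mul_eq_mul_div, div_le_iff₀ hpi] at h3
      linarith
  refine (measure_mono hsub).trans ((measure_biUnion_finset_le _ _).trans ?_)
  simp only [Real.volume_closedBall, Finset.sum_const, Int.card_Icc, nsmul_eq_mul]
  have e : ((T:ℤ) + 2 + 1 - -((T:ℤ) + 2)).toNat = 2 * T + 5 := by omega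
  rw [e, ← ENNReal.ofReal_natCast, ← ENNReal.ofReal_mul (by positivity)]
  apply le_of_eq
  congr 1
  push_cast; ring

lemma angular (T : ℕ) : ∃ A : ℝ≥0∞, A ≠ ∞ ∧ ∀ (N : ℕ) (u : E2),
    2 ^ N * volume ({θ : ℝ | |pr θ u| ≤ (1/2) ^ N} ∩ Set.Icc (-(T:ℝ)) T) ≤
      A * (1 + ∑ n ∈ Finset.range (N + 1), 2 ^ n * Set.indicator (Metric.closedBall 0 ((1/2) ^ n)) 1 u) := by
  set A0 : ℝ := (2 * T + 5) * Real.pi with hA0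
  have hA0p : 0 < A0 := by positivity
  refine ⟨ENNReal.ofReal (2 * A0 + 2 * T), ENNReal.ofReal_ne_top, fun N u => ?_⟩
  have two : ∀ n : ℕ, (2:ℝ≥0∞) ^ n = ENNReal.ofReal (2 ^ n) := by
    intro n; rw [ENNReal.ofReal_pow (by norm_num)]; simp
  have hterm : ∀ n ≤ N, ‖u‖ ≤ (1/2) ^ n → (2:ℝ≥0∞) ^ n ≤ 1 + ∑ n ∈ Finset.range (N + 1), 2 ^ n * Set.indicator (Metric.closedBall 0 ((1/2) ^ n)) 1 u := by
    intro n hn hu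
    refine le_trans ?_ le_add_self
    refine le_trans ?_ (Finset.single_le_sum (f := fun n => (2:ℝ≥0∞) ^ n * Set.indicator (Metric.closedBall 0 ((1/2) ^ n)) 1 u)
      (fun _ _ => zero_le) (Finset.mem_range.mpr (Nat.lt_succ_of_le hn)))
    have : u ∈ Metric.closedBall (0:E2) ((1/2) ^ n) := by simpa using hu
    rw [Set.indicator_of_mem this, Pi.one_apply, mul_one]
  have hpow : ∀ n : ℕ, (2:ℝ) ^ n * (1/2) ^ n = 1 := by
    intro n; rw [← mul_pow]; norm_num
  by_cases hN : ‖u‖ ≤ (1/2) ^ N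
  · calc 2 ^ N * volume ({θ : ℝ | |pr θ u| ≤ (1/2) ^ N} ∩ Set.Icc (-(T:ℝ)) T)
        ≤ 2 ^ N * ENNReal.ofReal (2 * A0 + 2 * T) := by
          gcongr
          refine (measure_mono Set.inter_subset_right).trans ?_
          rw [Real.volume_Icc]
          apply ENNReal.ofReal_le_ofReal; linarith
      _ = ENNReal.ofReal (2 * A0 + 2 * T) * 2 ^ N := mul_comm _ _
      _ ≤ _ := by gcongr; exact hterm N le_rfl hN
  · push Not at hN
    have hu0 : 0 < ‖u‖ := lt_trans (by positivity) hN
    have hcore := angular_core T u (norm_pos_iff.mp hu0) ((1/2) ^ N)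
    rw [← hA0] at hcore
    have h1 : 2 ^ N * volume ({θ : ℝ | |pr θ u| ≤ (1/2) ^ N} ∩ Set.Icc (-(T:ℝ)) T) ≤ ENNReal.ofReal (A0 / ‖u‖) := by
      refine (mul_le_mul_right hcore _).trans ?_
      rw [two, ← ENNReal.ofReal_mul (by positivity)]
      apply le_of_eq; congr 1
      calc (2:ℝ) ^ N * (A0 * ((1/2) ^ N / ‖u‖)) = (2 ^ N * (1/2) ^ N) * (A0 / ‖u‖) := by ring
        _ = _ := by rw [hpow, one_mul]
    refine h1.trans ?_
    by_cases hu1 : 1 < ‖u‖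
    · calc ENNReal.ofReal (A0 / ‖u‖) ≤ ENNReal.ofReal (2 * A0 + 2 * T) * 1 := by
            rw [mul_one]
            apply ENNReal.ofReal_le_ofReal
            have : A0 / ‖u‖ ≤ A0 := div_le_self hA0p.le hu1.le
            have hTn : (0:ℝ) ≤ T := Nat.cast_nonneg T
            linarith
        _ ≤ _ := by gcongr; exact le_self_add
    · push Not at hu1
      obtain ⟨n, hn1, hn2⟩ := exists_nat_pow_near_of_lt_one hu0 hu1 (show (0:ℝ) < 1/2 by norm_num) (by norm_num)
      have hnN : n ≤ N := by
        by_contra hcon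
        have : ((1:ℝ)/2) ^ n ≤ (1/2) ^ N := pow_le_pow_of_le_one (by norm_num) (by norm_num) (by omega)
        linarith
      calc ENNReal.ofReal (A0 / ‖u‖) ≤ ENNReal.ofReal (2 * A0 + 2 * T) * 2 ^ n := by
            rw [two, ← ENNReal.ofReal_mul (by positivity)]
            apply ENNReal.ofReal_le_ofReal
            rw [div_le_iff₀ hu0]
            have h2 : (1:ℝ) ≤ 2 * 2 ^ n * ‖u‖ := by
              have := hpow (n+1)
              have h3 : (2:ℝ) ^ (n+1) * (1/2) ^ (n+1) ≤ 2 ^ (n+1) * ‖u‖ := by gcongr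
              rw [this, pow_succ] at h3
              linarith
            have hTn : (0:ℝ) ≤ T := Nat.cast_nonneg T
            have h4 : (0:ℝ) ≤ 2 * T * 2 ^ n * ‖u‖ := by positivity
            nlinarith
        _ ≤ _ := by gcongr; exact hterm n hnN hn2

lemma measurableSet_pr (N : ℕ) : MeasurableSet {z : ℝ × (E2 × E2) | |pr z.1 (z.2.1 - z.2.2)| ≤ (1/2) ^ N} := by
  apply IsClosed.measurableSet
  apply isClosed_le
  · unfold pr; simp only [PiLp.sub_apply]; fun_prop
  · fun_prop

lemma energy (T : ℕ) (hβ2 : 2 * β < 1) : ∃ A : ℝ≥0∞, A ≠ ∞ ∧ ∀ (N : ℕ) (μ : Measure E2), μ Set.univ ≤ 1 →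
    (∀ n ≤ N, ∀ q, μ (cube n q) ≤ β ^ n) →
    ∫⁻ θ in Set.Icc (-(T:ℝ)) T, 2 ^ N * (μ.prod μ) {z | |pr θ (z.1 - z.2)| ≤ (1/2) ^ N} ≤ A := by
  obtain ⟨A, hA, hang⟩ := angular T
  refine ⟨A * (1 + 9 * ∑' n, (2 * β) ^ n), ?_, ?_⟩
  · rw [ENNReal.tsum_geometric]
    refine ENNReal.mul_ne_top hA (ENNReal.add_ne_top.mpr ⟨by simp, ENNReal.mul_ne_top (by simp) ?_⟩)
    rw [ENNReal.inv_ne_top]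
    exact (tsub_pos_of_lt hβ2).ne'
  intro N μ hμ1 hμ
  haveI : IsFiniteMeasure μ := ⟨hμ1.trans_lt ENNReal.one_lt_top⟩
  have hball : ∀ n ≤ N, ∀ x, μ (Metric.closedBall x ((1/2) ^ n)) ≤ 9 * β ^ n := by
    intro n hn x
    refine (measure_mono (ball_subset n x)).trans ((measure_biUnion_finset_le _ _).trans ?_)
    refine (Finset.sum_le_card_nsmul _ _ _ fun q _ => hμ n hn q).trans ?_
    rw [card_nbr]; simp
  set S : Set (ℝ × (E2 × E2)) := {z | |pr z.1 (z.2.1 - z.2.2)| ≤ (1/2) ^ N} with hS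
  have hSm : MeasurableSet S := measurableSet_pr N
  set ν := (volume : Measure ℝ).restrict (Set.Icc (-(T:ℝ)) T) with hν
  have e1 : ∫⁻ θ, (μ.prod μ) {z | |pr θ (z.1 - z.2)| ≤ (1/2) ^ N} ∂ν = ∫⁻ z, ν {θ | |pr θ (z.1 - z.2)| ≤ (1/2) ^ N} ∂(μ.prod μ) := by
    have a := Measure.prod_apply (μ := ν) (ν := μ.prod μ) hSm
    have b := Measure.prod_apply_symm (μ := ν) (ν := μ.prod μ) hSm
    rw [a] at b
    exact b
  have hm : ∀ z : E2 × E2, MeasurableSet {θ : ℝ | |pr θ (z.1 - z.2)| ≤ (1/2) ^ N} := by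
    intro z
    apply IsClosed.measurableSet
    apply isClosed_le
    · unfold pr; fun_prop
    · fun_prop
  have hmb : ∀ n : ℕ, MeasurableSet {z : E2 × E2 | dist z.2 z.1 ≤ (1/2) ^ n} := by
    intro n
    exact (isClosed_le (by fun_prop) (by fun_prop)).measurableSet
  calc ∫⁻ θ, 2 ^ N * (μ.prod μ) {z | |pr θ (z.1 - z.2)| ≤ (1/2) ^ N} ∂ν
      = 2 ^ N * ∫⁻ θ, (μ.prod μ) {z | |pr θ (z.1 - z.2)| ≤ (1/2) ^ N} ∂ν :=
        lintegral_const_mul' _ _ (by simp)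
    _ = ∫⁻ z, 2 ^ N * ν {θ | |pr θ (z.1 - z.2)| ≤ (1/2) ^ N} ∂(μ.prod μ) := by
        rw [e1, lintegral_const_mul' _ _ (by simp)]
    _ ≤ ∫⁻ z, A * (1 + ∑ n ∈ Finset.range (N + 1), 2 ^ n * Set.indicator {z : E2 × E2 | dist z.2 z.1 ≤ (1/2) ^ n} 1 z) ∂(μ.prod μ) := by
        refine lintegral_mono fun z => ?_
        have := hang N (z.1 - z.2)
        rw [hν, Measure.restrict_apply (hm z)]
        refine this.trans (le_of_eq ?_)
        congr 2
        refine Finset.sum_congr rfl fun n _ => ?_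
        congr 1
        have hiff : z.1 - z.2 ∈ Metric.closedBall (0 : E2) ((1/2) ^ n) ↔
            z ∈ {z : E2 × E2 | dist z.2 z.1 ≤ (1/2) ^ n} := by
          rw [Metric.mem_closedBall, dist_zero_right, Set.mem_ofPred_eq, dist_comm, dist_eq_norm]
        by_cases hz : z ∈ {z : E2 × E2 | dist z.2 z.1 ≤ (1/2) ^ n}
        · rw [Set.indicator_of_mem hz, Set.indicator_of_mem (hiff.mpr hz)]; rfl
        · rw [Set.indicator_of_notMem hz, Set.indicator_of_notMem (fun h => hz (hiff.mp h))]
    _ = A * ((μ.prod μ) Set.univ + ∑ n ∈ Finset.range (N + 1), 2 ^ n * (μ.prod μ) {z : E2 × E2 | dist z.2 z.1 ≤ (1/2) ^ n}) := by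
        rw [lintegral_const_mul' _ _ hA, lintegral_add_left measurable_const, lintegral_finsetSum']
        · congr 2
          · simp
          · refine Finset.sum_congr rfl fun n _ => ?_
            rw [lintegral_const_mul' _ _ (by simp), lintegral_indicator_one (hmb n)]
        · intro n _
          exact ((measurable_one.indicator (hmb n)).const_mul _).aemeasurable
    _ ≤ A * (1 + ∑ n ∈ Finset.range (N + 1), 2 ^ n * (9 * β ^ n)) := by
        gcongr with n hn
        · rw [← Set.univ_prod_univ, Measure.prod_prod]
          exact mul_le_one' hμ1 hμ1
        · rw [Measure.prod_apply (hmb n)]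
          calc _ ≤ ∫⁻ x, 9 * β ^ n ∂μ := by
                refine lintegral_mono fun x => hball n (by simp at hn; omega) x
            _ ≤ 9 * β ^ n := by
                rw [lintegral_const]
                exact mul_le_of_le_one_right' hμ1
    _ ≤ _ := by
        gcongr
        rw [← ENNReal.tsum_mul_left]
        refine le_trans (le_of_eq ?_) (ENNReal.sum_le_tsum (Finset.range (N + 1)))
        refine Finset.sum_congr rfl fun n _ => ?_
        rw [mul_pow]; ring

lemma main_Icc (T : ℕ) (hβ2 : 2 * β < 1) (C : Set E2) (hC : IsCompact C) (p₀ : ℤ × ℤ)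
    (hsub : C ⊆ cube 0 p₀) (hpos : M β hβ C ≠ 0) :
    ∀ᵐ θ ∂((volume : Measure ℝ).restrict (Set.Icc (-(T:ℝ)) T)), 0 < volume (pr θ '' C) := by
  obtain ⟨A, hA, hen⟩ := energy T hβ2
  set m := M β hβ C with hm
  have hm1 : m ≤ 1 := by
    have := (measure_mono hsub).trans (M_cube_le (hβ := hβ) 0 p₀)
    simpa using this
  have hfr : ∀ N, ∃ μ : Measure E2, μ Set.univ = m ∧ μ Cᶜ = 0 ∧ ∀ n ≤ N, ∀ q, μ (cube n q) ≤ β ^ n := by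
    intro N
    obtain ⟨μ, h1, _, h3, h4⟩ := frostman (hβ := hβ) C N 0 p₀ m (by rw [Set.inter_eq_left.mpr hsub])
    refine ⟨μ, h1, h3 C subset_rfl hC.measurableSet, ?_⟩
    simpa using h4
  choose μ h1 h2 h3 using hfr
  haveI : ∀ N, IsFiniteMeasure (μ N) := fun N => ⟨by rw [h1]; exact hm1.trans_lt ENNReal.one_lt_top⟩
  set S : ℕ → ℝ → ℝ≥0∞ := fun N θ => 2 ^ N * ((μ N).prod (μ N)) {z | |pr θ (z.1 - z.2)| ≤ (1/2) ^ N} with hS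
  have hSm : ∀ N, Measurable (S N) := fun N =>
    (measurable_measure_prodMk_left (measurableSet_pr N)).const_mul _
  have hfat : ∫⁻ θ in Set.Icc (-(T:ℝ)) T, Filter.liminf (fun N => S N θ) Filter.atTop ≤ A := by
    refine (lintegral_liminf_le hSm).trans ?_
    refine Filter.liminf_le_of_frequently_le' (Filter.Frequently.of_forall fun N => ?_)
    exact hen N (μ N) (by rw [h1]; exact hm1) (h3 N)
  have hae := ae_lt_top (Measurable.liminf hSm) (hfat.trans_lt hA.lt_top).ne
  filter_upwards [hae] with θ hθ
  rw [pos_iff_ne_zero]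
  intro hnull
  have hprc : Continuous (pr θ) := by unfold pr; fun_prop
  have hcs : ∀ (N : ℕ) (a : ℝ≥0∞), 2 * a * m ≤ S N θ + a ^ 2 * volume (Metric.cthickening ((1/2) ^ N / 2) (pr θ '' C)) := by
    intro N a
    have hB : ((μ N).map (pr θ)) (pr θ '' C)ᶜ = 0 := by
      rw [Measure.map_apply hprc.measurable (hC.image hprc).measurableSet.compl]
      exact measure_mono_null (fun x hx hxC => hx ⟨x, hxC, rfl⟩) (h2 N)
    have := cs ((μ N).map (pr θ)) (pr θ '' C) hB ((1/2) ^ N / 2) (by positivity) a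
    have e2 : (2:ℝ) * ((1/2) ^ N / 2) = (1/2) ^ N := by ring
    rw [e2, Measure.map_apply hprc.measurable MeasurableSet.univ, Set.preimage_univ, h1] at this
    refine this.trans (le_of_eq ?_)
    congr 1
    rw [hS, Measure.map_prod_map _ _ hprc.measurable hprc.measurable, Measure.map_apply (by fun_prop)
      (isClosed_le (by fun_prop) (by fun_prop)).measurableSet, ENNReal.div_eq_inv_mul]
    congr 1
    · rw [← ENNReal.ofReal_inv_of_pos (by positivity), one_div, inv_pow, inv_inv, ENNReal.ofReal_pow (by norm_num)]
      simp
    · congr 1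
      ext z
      simp only [Set.mem_preimage, Set.mem_ofPred_eq, Prod.map_fst, Prod.map_snd]
      have : pr θ (z.1 - z.2) = pr θ z.1 - pr θ z.2 := by
        simp [pr]; ring
      rw [this]
  set L := Filter.liminf (fun N => S N θ) Filter.atTop with hL
  have hkey : ∀ a : ℕ, 2 * (a:ℝ≥0∞) * m ≤ L + 2 := by
    intro a
    have hlt : L < L + 1 := ENNReal.lt_add_right hθ.ne (by simp)
    have hfreq := Filter.frequently_lt_of_liminf_lt (by isBoundedDefault) (hL ▸ hlt)
    have hr : Filter.Tendsto (fun N : ℕ => ((1:ℝ)/2) ^ N / 2) Filter.atTop (nhds 0) := by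
      have := (tendsto_pow_atTop_nhds_zero_of_lt_one (show (0:ℝ) ≤ 1/2 by norm_num) (by norm_num)).div_const 2
      simpa using this
    have ht := (tendsto_measure_cthickening_of_isCompact (μ := volume) (hC.image hprc)).comp hr
    rw [hnull] at ht
    have ht2 : Filter.Tendsto (fun N : ℕ => (a:ℝ≥0∞) ^ 2 * volume (Metric.cthickening ((1/2) ^ N / 2) (pr θ '' C))) Filter.atTop (nhds 0) := by
      have := ENNReal.Tendsto.const_mul ht (a := (a:ℝ≥0∞) ^ 2) (Or.inr (by simp))
      simpa using this
    have hev := ht2.eventually_lt_const (show (0:ℝ≥0∞) < 1 by simp)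
    obtain ⟨N, hN1, hN2⟩ := (hfreq.and_eventually hev).exists
    calc 2 * (a:ℝ≥0∞) * m ≤ _ := hcs N a
      _ ≤ (L + 1) + 1 := by gcongr
      _ = L + 2 := by rw [add_assoc]; norm_num
  have hLt : (L + 2) / (2 * m) ≠ ∞ := by
    refine ENNReal.div_ne_top (ENNReal.add_ne_top.mpr ⟨hθ.ne, by simp⟩) ?_
    exact mul_ne_zero (by simp) hpos
  obtain ⟨a, ha⟩ := ENNReal.exists_nat_gt hLt
  rw [ENNReal.div_lt_iff (Or.inl (mul_ne_zero (by simp) hpos)) (Or.inl (ENNReal.mul_ne_top (by simp) (ne_top_of_le_ne_top ENNReal.one_ne_top hm1)))] at ha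
  refine absurd (hkey a) (not_le.mpr (ha.trans_le (le_of_eq ?_)))
  ring

theorem main (K : Set E2) (hK : MeasurableSet K) (hdim : 1 < dimH K) :
    ∀ᵐ θ : ℝ, 0 < volume (pr θ '' K) := by
  obtain ⟨s, hs1, hs2⟩ := ENNReal.lt_iff_exists_nnreal_btwn.mp hdim
  have hs1' : (1:ℝ) < s := by exact_mod_cast hs1
  have hH := hausdorffMeasure_of_lt_dimH hs2
  set β : ℝ≥0∞ := ENNReal.ofReal ((1/2 : ℝ) ^ (s:ℝ)) with hβd
  have hlt : ((1:ℝ)/2) ^ (s:ℝ) < 1/2 := by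
    have := Real.rpow_lt_rpow_of_exponent_gt (show (0:ℝ) < 1/2 by norm_num) (by norm_num) hs1'
    rwa [Real.rpow_one] at this
  have hβ2 : 2 * β < 1 := by
    have : (2:ℝ≥0∞) = ENNReal.ofReal 2 := by simp
    rw [hβd, this, ← ENNReal.ofReal_mul (by norm_num), ENNReal.ofReal_lt_one]
    linarith
  have hβ : β < 1 := by
    rw [hβd, ENNReal.ofReal_lt_one]; linarith
  have hM : M β hβ K ≠ 0 := by
    intro h0
    rw [hausdorff_null (hβ := hβ) s (by linarith) hβd K h0] at hH
    simp at hH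
  obtain ⟨C, hCK, p₀, hC, hsub, hCpos⟩ := exists_compact_subset K hK hM
  have hall : ∀ T : ℕ, ∀ᵐ θ ∂((volume : Measure ℝ).restrict (Set.Icc (-(T:ℝ)) T)), 0 < volume (pr θ '' C) :=
    fun T => main_Icc T hβ2 C hC p₀ hsub hCpos
  have := ae_restrict_iUnion_iff (μ := (volume : Measure ℝ)) (fun T : ℕ => Set.Icc (-(T:ℝ)) T) (fun θ => 0 < volume (pr θ '' C))
  have h2 := this.mpr hall
  have hU : (⋃ T : ℕ, Set.Icc (-(T:ℝ)) T) = Set.univ := by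
    rw [Set.eq_univ_iff_forall]
    intro x
    obtain ⟨T, hT⟩ := exists_nat_ge |x|
    exact Set.mem_iUnion.mpr ⟨T, abs_le.mp hT⟩
  rw [hU, Measure.restrict_univ] at h2
  filter_upwards [h2] with θ hθ
  exact hθ.trans_le (measure_mono (Set.image_mono hCK))

end Marstrand

/-- Marstrand's projection theorem in the Euclidean plane: if `K ⊆ ℝ²` is a Borel set
with Hausdorff dimension greater than `1`, then for Lebesgue-almost every `θ` the
orthogonal projection of `K` onto the line in direction `(cos θ, sin θ)` has positive
one-dimensional Lebesgue measure. -/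
theorem stmt_18 (K : Set (EuclideanSpace ℝ (Fin 2))) (hK : MeasurableSet K)
    (hdim : 1 < dimH K) :
    ∀ᵐ θ : ℝ ∂(volume : Measure ℝ),
      0 < volume ((fun v : EuclideanSpace ℝ (Fin 2) =>
        Real.cos θ * v 0 + Real.sin θ * v 1) '' K) := by
  exact Marstrand.main K hK hdim
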